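/- arXiv:2009.10754 — 2 statements merged into one kernel-verified Lean document; each statement's English description precedes it below -/
import Mathlib

section
/- There is a constant C > 0 such that the following holds. Let ‖·‖ be a norm on ℝ^m whose Banach–Mazur distance to the Euclidean norm is D, i.e. D is the infimum over invertible linear maps T : ℝ^m → ℝ^m of the smallest d such that ‖T(x)‖₂ ≤ ‖x‖ ≤ d·‖T(x)‖₂ for all x ∈ ℝ^m. Then for every f : {-1,1}^n → ℝ^m, with X uniform on {-1,1}^n, (E[‖Rad f(X)‖²])^{1/2} ≤ C·log(D+1)·(E[‖f(X)‖²])^{1/2}. -/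
open Finset Real

noncomputable section

/-- The discrete cube `{-1,1}^n` as a finite set of points of `ℝ^n`. -/
def cube (n : ℕ) : Finset (Fin n → ℝ) :=
  Fintype.piFinset fun _ => ({-1, 1} : Finset ℝ)

/-- Expectation of `g(X)` for `X` uniform on the discrete cube `{-1,1}^n`. -/
def cubeAvg (n : ℕ) (g : (Fin n → ℝ) → ℝ) : ℝ :=
  (∑ x ∈ cube n, g x) / (2 : ℝ) ^ n

/-- Fourier coefficient `f̂(S) = E[f(X)·χ_S(X)]` of a (vector-valued) function on the cube. -/
def cubeFourier {E : Type*} [AddCommGroup E] [Module ℝ E]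
    (n : ℕ) (f : (Fin n → ℝ) → E) (S : Finset (Fin n)) : E :=
  (((2 : ℝ) ^ n)⁻¹) • ∑ x ∈ cube n, (∏ j ∈ S, x j) • f x

/-- The Rademacher projection (linear part) `Rad f(x) = Σ_j f̂({j})·x_j`. -/
def rad {E : Type*} [AddCommGroup E] [Module ℝ E]
    (n : ℕ) (f : (Fin n → ℝ) → E) (x : Fin n → ℝ) : E :=
  ∑ j : Fin n, x j • cubeFourier n f {j}

/-- The Euclidean norm on `ℝ^m`. -/
def euclNorm (m : ℕ) (x : Fin m → ℝ) : ℝ :=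
  Real.sqrt (∑ i, (x i) ^ 2)

/-- `sum_range cos (2π j k / M)` and the sine analogue vanish at nonzero frequencies. -/
theorem sum_cos_sin_eq_zero {M : ℕ} {j : ℤ} (hj : j ≠ 0) (hjM : |j| < M) :
    ∑ k ∈ range M, cos (j * (2 * π * k / M)) = 0 ∧
      ∑ k ∈ range M, sin (j * (2 * π * k / M)) = 0 := by
  have hM : M ≠ 0 := by rintro rfl; have := abs_nonneg j; simp at hjM; omega
  have hζ := Complex.isPrimitiveRoot_exp M hM
  set ζ := Complex.exp (2 * π * Complex.I / M) with hζd
  have h1 : ζ ^ j ≠ 1 := by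
    rw [Ne, hζ.zpow_eq_one_iff_dvd]
    intro hd
    exact hj (Int.eq_zero_of_abs_lt_dvd hd hjM)
  have h2 : ∑ k ∈ range M, (ζ ^ j) ^ k = 0 := by
    rw [geom_sum_eq h1, ← zpow_natCast, ← zpow_mul, mul_comm, zpow_mul, zpow_natCast,
      hζ.pow_eq_one]
    simp
  have h3 : ∀ k : ℕ, (ζ ^ j) ^ k = Complex.exp (((j * (2 * π * k / M) : ℝ) : ℂ) * Complex.I) := by
    intro k
    rw [hζd, ← Complex.exp_int_mul, ← Complex.exp_nat_mul]
    congr 1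
    push_cast
    ring
  simp only [h3] at h2
  constructor
  · have := congrArg Complex.re h2
    simpa only [Complex.re_sum, Complex.exp_ofReal_mul_I_re, Complex.zero_re] using this
  · have := congrArg Complex.im h2
    simpa only [Complex.im_sum, Complex.exp_ofReal_mul_I_im, Complex.zero_im] using this

theorem sum_cos_grid {M : ℕ} {j : ℤ} (hjM : |j| < M) :
    ∑ k ∈ range M, cos (j * (2 * π * k / M)) = if j = 0 then (M : ℝ) else 0 := by
  split_ifs with h
  · simp [h]
  · exact (sum_cos_sin_eq_zero h hjM).1

theorem sum_sin_grid {M : ℕ} {j : ℤ} (hjM : |j| < M) :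
    ∑ k ∈ range M, sin (j * (2 * π * k / M)) = 0 := by
  by_cases h : j = 0
  · simp [h]
  · exact (sum_cos_sin_eq_zero h hjM).2

/-- The (unnormalized) Fejér kernel of order `d`. -/
def fejer (d : ℕ) (θ : ℝ) : ℝ :=
  ∑ a ∈ range d, ∑ b ∈ range d, cos (((a : ℤ) - (b : ℤ) : ℤ) * θ)

theorem fejer_nonneg (d : ℕ) (θ : ℝ) : 0 ≤ fejer d θ := by
  have : fejer d θ = (∑ a ∈ range d, cos (a * θ)) ^ 2 + (∑ a ∈ range d, sin (a * θ)) ^ 2 := by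
    simp only [fejer, sq, sum_mul_sum, ← sum_add_distrib]
    refine sum_congr rfl fun a _ => sum_congr rfl fun b _ => ?_
    push_cast
    rw [sub_mul, cos_sub]
  rw [this]
  positivity

theorem sum_range_range_ite_eq (d l : ℕ) :
    ∑ a ∈ range d, ∑ b ∈ range d, (if a = b + l then (1 : ℝ) else 0) = ((d - l : ℕ) : ℝ) := by
  rw [sum_comm]
  have : ∀ b ∈ range d, ∑ a ∈ range d, (if a = b + l then (1 : ℝ) else 0) =
      if b < d - l then 1 else 0 := by
    intro b _
    rw [sum_ite_eq']
    simp only [mem_range]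
    congr 1
    simp only [eq_iff_iff]
    omega
  rw [sum_congr rfl this, ← sum_filter, sum_const, nsmul_eq_mul, mul_one]
  congr 1
  rw [show (range d).filter (fun b => b < d - l) = range (d - l) by ext; simp; omega, card_range]

theorem sum_cos_mul_fejer {d l M : ℕ} (hM : l + d ≤ M) :
    ∑ k ∈ range M, cos ((l : ℤ) * (2 * π * k / M)) * fejer d (2 * π * k / M) =
      M * ((d - l : ℕ) : ℝ) := by
  have key : ∀ a ∈ range d, ∀ b ∈ range d,
      ∑ k ∈ range M, cos ((l : ℤ) * (2 * π * k / M)) *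
        cos (((a : ℤ) - (b : ℤ) : ℤ) * (2 * π * k / M)) =
      M / 2 * (if a = b + l then (1 : ℝ) else 0) + M / 2 * (if b = a + l then (1 : ℝ) else 0) := by
    intro a ha b hb
    rw [mem_range] at ha hb
    have h1 : |(l : ℤ) - (a - b)| < M := by rw [abs_lt]; omega
    have h2 : |(l : ℤ) + (a - b)| < M := by rw [abs_lt]; omega
    have e : ∀ k : ℕ, cos ((l : ℤ) * (2 * π * k / M)) *
        cos (((a : ℤ) - (b : ℤ) : ℤ) * (2 * π * k / M)) =
        1 / 2 * cos (((l : ℤ) - (a - b) : ℤ) * (2 * π * k / M)) +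
        1 / 2 * cos (((l : ℤ) + (a - b) : ℤ) * (2 * π * k / M)) := by
      intro k
      push_cast
      rw [sub_mul (l : ℝ), add_mul (l : ℝ), cos_sub, cos_add]
      ring
    simp only [e]
    rw [sum_add_distrib, ← mul_sum, ← mul_sum, sum_cos_grid h1, sum_cos_grid h2]
    have i1 : (l : ℤ) - (a - b) = 0 ↔ a = b + l := by omega
    have i2 : (l : ℤ) + (a - b) = 0 ↔ b = a + l := by omega
    simp only [i1, i2]
    split_ifs <;> ring
  simp only [fejer, mul_sum]
  rw [sum_comm]
  have : ∀ a ∈ range d, ∑ k ∈ range M, ∑ b ∈ range d, cos ((l : ℤ) * (2 * π * k / M)) *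
        cos (((a : ℤ) - (b : ℤ) : ℤ) * (2 * π * k / M)) =
      ∑ b ∈ range d, (M / 2 * (if a = b + l then (1 : ℝ) else 0) +
        M / 2 * (if b = a + l then (1 : ℝ) else 0)) := by
    intro a ha
    rw [sum_comm]
    exact sum_congr rfl fun b hb => key a ha b hb
  rw [sum_congr rfl this]
  simp only [sum_add_distrib, ← mul_sum]
  rw [sum_range_range_ite_eq, sum_comm, sum_range_range_ite_eq]
  ring

theorem sum_sin_mul_fejer {d M : ℕ} {l : ℤ} (hM : |l| + d ≤ M) :
    ∑ k ∈ range M, sin (l * (2 * π * k / M)) * fejer d (2 * π * k / M) = 0 := by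
  simp only [fejer, mul_sum]
  rw [sum_comm]
  refine sum_eq_zero fun a ha => ?_
  rw [sum_comm]
  refine sum_eq_zero fun b hb => ?_
  rw [mem_range] at ha hb
  have hl := abs_le.1 (le_refl |l|)
  have h1 : |l - (a - b)| < M := by rw [abs_lt]; omega
  have h2 : |l + (a - b)| < M := by rw [abs_lt]; omega
  have e : ∀ k : ℕ, sin (l * (2 * π * k / M)) *
      cos (((a : ℤ) - (b : ℤ) : ℤ) * (2 * π * k / M)) =
      1 / 2 * sin ((l - (a - b) : ℤ) * (2 * π * k / M)) +
      1 / 2 * sin ((l + (a - b) : ℤ) * (2 * π * k / M)) := by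
    intro k
    push_cast
    rw [sub_mul (l : ℝ), add_mul (l : ℝ), sin_sub, sin_add]
    ring
  simp only [e]
  rw [sum_add_distrib, ← mul_sum, ← mul_sum, sum_sin_grid h1, sum_sin_grid h2]
  simp

/-- A discrete form of Bernstein's inequality at the origin: the linear coefficient of polynomials
of degree at most `d` is given by a signed measure on `[-1,1]` of total mass at most `2d`. -/
theorem exists_linear_coeff_quadrature (d : ℕ) (hd : 1 ≤ d) :
    ∃ (M : ℕ) (w s : ℕ → ℝ), (∀ i, |s i| ≤ 1) ∧ ∑ i ∈ range M, |w i| ≤ 2 * d ∧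
      ∀ k ≤ d, ∑ i ∈ range M, w i * s i ^ k = if k = 1 then 1 else 0 := by
  obtain ⟨M, hM⟩ : ∃ M, M = 3 * d := ⟨_, rfl⟩
  have hM0 : (0 : ℝ) < M := by rw [hM]; norm_cast; omega
  set t : ℕ → ℝ := fun k => 2 * π * k / M with ht
  set w : ℕ → ℝ := fun k => (2 * sin ((d : ℤ) * t k) * fejer d (t k)) / M with hw
  have base_sin : ∀ j : ℤ, |j| ≤ d → ∑ k ∈ range M, w k * sin (j * t k) = j := by
    intro j hj
    rw [abs_le] at hj
    obtain ⟨p, hp⟩ : ∃ p : ℕ, (p : ℤ) = d - j := ⟨(d - j).toNat, by omega⟩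
    obtain ⟨q, hq⟩ : ∃ q : ℕ, (q : ℤ) = d + j := ⟨(d + j).toNat, by omega⟩
    have e : ∀ k, w k * sin (j * t k) =
        (cos ((p : ℤ) * t k) * fejer d (t k) - cos ((q : ℤ) * t k) * fejer d (t k)) / M := by
      intro k
      rw [hp, hq]
      simp only [hw]
      push_cast
      rw [sub_mul, add_mul, cos_sub, cos_add]
      ring
    simp only [e]
    rw [← sum_div, sum_sub_distrib, sum_cos_mul_fejer (by omega),
      sum_cos_mul_fejer (by omega), ← mul_sub, mul_div_cancel_left₀ _ hM0.ne']
    have : ((d - p : ℕ) : ℤ) - ((d - q : ℕ) : ℤ) = j := by omega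
    exact_mod_cast this
  have base_cos : ∀ j : ℤ, |j| ≤ d → ∑ k ∈ range M, w k * cos (j * t k) = 0 := by
    intro j hj
    rw [abs_le] at hj
    have e : ∀ k, w k * cos (j * t k) =
        (sin ((d - j : ℤ) * t k) * fejer d (t k) + sin ((d + j : ℤ) * t k) * fejer d (t k)) / M := by
      intro k
      simp only [hw]
      push_cast
      rw [sub_mul, add_mul, sin_sub, sin_add]
      ring
    have h1 : |(d : ℤ) - j| + d ≤ M := by
      have : |(d : ℤ) - j| ≤ 2 * d := by rw [abs_le]; omega
      omega
    have h2 : |(d : ℤ) + j| + d ≤ M := by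
      have : |(d : ℤ) + j| ≤ 2 * d := by rw [abs_le]; omega
      omega
    simp only [e]
    rw [← sum_div, sum_add_distrib, sum_sin_mul_fejer h1, sum_sin_mul_fejer h2]
    simp
  have step : ∀ k : ℕ, ∀ j : ℤ, |j| + k ≤ d →
      ∑ i ∈ range M, w i * (sin (t i) ^ k * sin (j * t i)) = (if k = 0 then (j : ℝ) else 0) ∧
      ∑ i ∈ range M, w i * (sin (t i) ^ k * cos (j * t i)) = (if k = 1 then (1 : ℝ) else 0) := by
    intro k
    induction k with
    | zero =>
      intro j hj
      have hj' : |j| ≤ d := by push_cast at hj; omega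
      simpa using And.intro (base_sin j hj') (base_cos j hj')
    | succ k ih =>
      intro j hj
      have hj0 := abs_le.1 (le_refl |j|)
      have h1 : |j + 1| + k ≤ d := by
        have : |j + 1| ≤ |j| + 1 := by rw [abs_le]; omega
        push_cast at hj
        omega
      have h2 : |j - 1| + k ≤ d := by
        have : |j - 1| ≤ |j| + 1 := by rw [abs_le]; omega
        push_cast at hj
        omega
      obtain ⟨s1, c1⟩ := ih _ h1
      obtain ⟨s2, c2⟩ := ih _ h2
      have es : ∀ i, w i * (sin (t i) ^ (k + 1) * sin (j * t i)) =
          1 / 2 * (w i * (sin (t i) ^ k * cos ((j - 1 : ℤ) * t i))) -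
          1 / 2 * (w i * (sin (t i) ^ k * cos ((j + 1 : ℤ) * t i))) := by
        intro i
        push_cast
        rw [sub_mul, add_mul, one_mul, cos_sub, cos_add]
        ring
      have ec : ∀ i, w i * (sin (t i) ^ (k + 1) * cos (j * t i)) =
          1 / 2 * (w i * (sin (t i) ^ k * sin ((j + 1 : ℤ) * t i))) -
          1 / 2 * (w i * (sin (t i) ^ k * sin ((j - 1 : ℤ) * t i))) := by
        intro i
        push_cast
        rw [sub_mul, add_mul, one_mul, sin_sub, sin_add]
        ring
      simp only [es, ec]
      rw [sum_sub_distrib, sum_sub_distrib, ← mul_sum, ← mul_sum, ← mul_sum, ← mul_sum,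
        s1, s2, c1, c2]
      constructor
      · simp
      · by_cases hk : k = 0
        · simp [hk]; ring
        · simp [hk]
  refine ⟨M, w, fun i => sin (t i), fun i => abs_sin_le_one _, ?_, fun k hk => ?_⟩
  · have h1 : ∀ k ∈ range M, |w k| ≤ 2 / M * (cos (((0 : ℕ) : ℤ) * t k) * fejer d (t k)) := by
      intro k _
      have hF := fejer_nonneg d (t k)
      simp only [hw, Nat.cast_zero, Int.cast_zero, zero_mul, cos_zero, one_mul]
      rw [abs_div, abs_mul, abs_mul, abs_of_nonneg hF, abs_of_pos hM0, abs_two, div_mul_eq_mul_div]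
      have := abs_sin_le_one ((d : ℤ) * t k)
      gcongr
      nlinarith
    refine (sum_le_sum h1).trans ?_
    rw [← mul_sum, sum_cos_mul_fejer (by omega)]
    simp only [tsub_zero]
    rw [← mul_assoc, div_mul_cancel₀ _ hM0.ne']
  · have := (step k 0 (by simpa using hk)).2
    simpa using this

theorem mem_cube {n : ℕ} {x : Fin n → ℝ} : x ∈ cube n ↔ ∀ j, x j = -1 ∨ x j = 1 := by
  simp [cube]

theorem mul_mem_cube {n : ℕ} {x y : Fin n → ℝ} (hx : x ∈ cube n) (hy : y ∈ cube n) :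
    x * y ∈ cube n := by
  rw [mem_cube] at *
  intro j
  rcases hx j with h | h <;> rcases hy j with h' | h' <;> simp [h, h']

theorem mul_self_of_mem_cube {n : ℕ} {x : Fin n → ℝ} (hx : x ∈ cube n) : x * x = 1 := by
  rw [mem_cube] at hx
  ext j
  rcases hx j with h | h <;> simp [h]

theorem sum_cube_mul_left {n : ℕ} {E : Type*} [AddCommMonoid E] {x : Fin n → ℝ} (hx : x ∈ cube n)
    (h : (Fin n → ℝ) → E) : ∑ y ∈ cube n, h (x * y) = ∑ y ∈ cube n, h y := by
  refine sum_nbij' (fun y => x * y) (fun y => x * y) (fun y hy => mul_mem_cube hx hy)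
    (fun y hy => mul_mem_cube hx hy) ?_ ?_ (fun _ _ => rfl)
  all_goals
    intro y _
    rw [← mul_assoc, mul_self_of_mem_cube hx, one_mul]

theorem sum_cube_prod {n : ℕ} (g : Fin n → ℝ → ℝ) :
    ∑ y ∈ cube n, ∏ j, g j (y j) = ∏ j, (g j (-1) + g j 1) := by
  rw [cube, ← prod_univ_sum]
  refine prod_congr rfl fun j _ => ?_
  rw [sum_pair (by norm_num)]

/-- The `S`-th Walsh character. -/
def walsh {n : ℕ} (S : Finset (Fin n)) (x : Fin n → ℝ) : ℝ := ∏ j ∈ S, x j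

theorem walsh_eq_prod_univ {n : ℕ} (S : Finset (Fin n)) (x : Fin n → ℝ) :
    walsh S x = ∏ j, if j ∈ S then x j else 1 := by
  rw [walsh, prod_ite_mem, univ_inter]

theorem walsh_mul {n : ℕ} (S : Finset (Fin n)) (x y : Fin n → ℝ) :
    walsh S (x * y) = walsh S x * walsh S y := by
  simp [walsh, prod_mul_distrib]

theorem sum_walsh_mul_walsh {n : ℕ} {x y : Fin n → ℝ} (hx : x ∈ cube n) (hy : y ∈ cube n) :
    ∑ S, walsh S x * walsh S y = if x = y then (2 : ℝ) ^ n else 0 := by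
  have h : ∑ S, walsh S x * walsh S y = ∏ j, (1 + x j * y j) := by
    rw [prod_one_add, powerset_univ]
    simp only [walsh, prod_mul_distrib]
  rw [h]
  rw [mem_cube] at hx hy
  split_ifs with hxy
  · subst hxy
    rw [prod_congr rfl (g := fun _ => (2 : ℝ)) fun j _ => by
      rcases hx j with h | h <;> rw [h] <;> norm_num]
    simp
  · obtain ⟨j, hj⟩ := Function.ne_iff.1 hxy
    refine prod_eq_zero (mem_univ j) ?_
    rcases hx j with h | h <;> rcases hy j with h' | h' <;>
      first | exact absurd (h.trans h'.symm) hj | (rw [h, h']; norm_num)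

theorem sum_sq_sum_walsh_mul {n : ℕ} (g : (Fin n → ℝ) → ℝ) :
    ∑ S, (∑ x ∈ cube n, walsh S x * g x) ^ 2 = 2 ^ n * ∑ x ∈ cube n, g x ^ 2 := by
  simp only [sq, sum_mul_sum]
  rw [sum_comm, mul_sum]
  refine sum_congr rfl fun x hx => ?_
  rw [sum_comm]
  have : ∀ y ∈ cube n, ∑ S, walsh S x * g x * (walsh S y * g y) =
      if x = y then 2 ^ n * (g x * g y) else 0 := by
    intro y hy
    have h := sum_walsh_mul_walsh hx hy
    rw [show ∑ S, walsh S x * g x * (walsh S y * g y) =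
      (∑ S, walsh S x * walsh S y) * (g x * g y) by
        rw [sum_mul]; exact sum_congr rfl fun S _ => by ring, h]
    split_ifs <;> simp
  rw [sum_congr rfl this, sum_ite_eq, if_pos hx]

/-- Convolution on the discrete cube, normalized by the uniform probability. -/
def cubeConv {E : Type*} [AddCommGroup E] [Module ℝ E] (n : ℕ) (K : (Fin n → ℝ) → ℝ)
    (f : (Fin n → ℝ) → E) (x : Fin n → ℝ) : E :=
  ((2 : ℝ) ^ n)⁻¹ • ∑ y ∈ cube n, K (x * y) • f y

theorem rad_eq_cubeConv {E : Type*} [AddCommGroup E] [Module ℝ E] {n : ℕ}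
    (f : (Fin n → ℝ) → E) (x : Fin n → ℝ) :
    rad n f x = cubeConv n (fun y => ∑ j, y j) f x := by
  simp only [rad, cubeConv, cubeFourier, prod_singleton]
  simp only [sum_smul, Pi.mul_apply]
  rw [sum_comm, smul_sum]
  refine sum_congr rfl fun j _ => ?_
  rw [smul_comm]
  simp only [smul_sum, mul_smul]

theorem cubeConv_add {E : Type*} [AddCommGroup E] [Module ℝ E] {n : ℕ}
    (K L : (Fin n → ℝ) → ℝ) (f : (Fin n → ℝ) → E) (x : Fin n → ℝ) :
    cubeConv n (fun y => K y + L y) f x = cubeConv n K f x + cubeConv n L f x := by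
  simp only [cubeConv, add_smul, sum_add_distrib, smul_add]

theorem map_cubeConv {E F : Type*} [AddCommGroup E] [Module ℝ E] [AddCommGroup F] [Module ℝ F]
    {n : ℕ} (T : E →ₗ[ℝ] F) (K : (Fin n → ℝ) → ℝ) (f : (Fin n → ℝ) → E) (x : Fin n → ℝ) :
    T (cubeConv n K f x) = cubeConv n K (fun y => T (f y)) x := by
  simp only [cubeConv, map_smul, map_sum]

theorem sum_walsh_mul_cubeConv {n : ℕ} (K g : (Fin n → ℝ) → ℝ) (S : Finset (Fin n)) :
    ∑ x ∈ cube n, walsh S x * cubeConv n K g x =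
      ((2 : ℝ) ^ n)⁻¹ * (∑ x ∈ cube n, walsh S x * K x) * ∑ x ∈ cube n, walsh S x * g x := by
  simp only [cubeConv, smul_eq_mul, mul_sum]
  rw [sum_comm]
  refine sum_congr rfl fun y hy => ?_
  rw [← sum_cube_mul_left hy, sum_mul]
  refine sum_congr rfl fun x _ => ?_
  rw [walsh_mul, show y * x * y = y * y * x by ring, mul_self_of_mem_cube hy, one_mul]
  ring

/-- The `L²` bound for a Fourier multiplier on the cube. -/
theorem sum_sq_cubeConv_le {n : ℕ} (K g : (Fin n → ℝ) → ℝ) (ε : ℝ)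
    (hK : ∀ S, |((2 : ℝ) ^ n)⁻¹ * ∑ x ∈ cube n, walsh S x * K x| ≤ ε) :
    ∑ x ∈ cube n, cubeConv n K g x ^ 2 ≤ ε ^ 2 * ∑ x ∈ cube n, g x ^ 2 := by
  have h2 : (0 : ℝ) < 2 ^ n := by positivity
  refine le_of_mul_le_mul_left ?_ h2
  rw [← sum_sq_sum_walsh_mul, mul_left_comm, ← sum_sq_sum_walsh_mul, mul_sum]
  refine sum_le_sum fun S _ => ?_
  rw [sum_walsh_mul_cubeConv, mul_pow]
  refine mul_le_mul_of_nonneg_right ?_ (sq_nonneg _)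
  rw [← sq_abs]
  exact pow_le_pow_left₀ (abs_nonneg _) (hK S) 2

/-- Young's inequality: convolution with `K` on `L²` of a seminormed space has norm at most
the `L¹` norm of `K`. -/
theorem sum_sq_seminorm_cubeConv_le {E : Type*} [AddCommGroup E] [Module ℝ E] {n : ℕ}
    (p : Seminorm ℝ E) (K : (Fin n → ℝ) → ℝ) (f : (Fin n → ℝ) → E) (A : ℝ)
    (hA : ((2 : ℝ) ^ n)⁻¹ * ∑ x ∈ cube n, |K x| ≤ A) :
    ∑ x ∈ cube n, p (cubeConv n K f x) ^ 2 ≤ A ^ 2 * ∑ x ∈ cube n, p (f x) ^ 2 := by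
  set c : ℝ := ((2 : ℝ) ^ n)⁻¹ with hc
  have hc0 : 0 < c := by positivity
  set B := ∑ x ∈ cube n, |K x| with hB
  have hB0 : 0 ≤ B := sum_nonneg fun _ _ => abs_nonneg _
  have h1 : ∀ x ∈ cube n, p (cubeConv n K f x) ^ 2 ≤
      c ^ 2 * (B * ∑ y ∈ cube n, |K (x * y)| * p (f y) ^ 2) := by
    intro x hx
    have e1 : p (cubeConv n K f x) ≤ c * ∑ y ∈ cube n, |K (x * y)| * p (f y) := by
      rw [cubeConv, map_smul_eq_mul, Real.norm_of_nonneg hc0.le]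
      refine mul_le_mul_of_nonneg_left ?_ hc0.le
      refine (le_sum_of_subadditive p (map_zero p).le (map_add_le_add p) _ _).trans (le_of_eq ?_)
      exact sum_congr rfl fun y _ => by rw [map_smul_eq_mul, Real.norm_eq_abs]
    have e2 : (∑ y ∈ cube n, |K (x * y)| * p (f y)) ^ 2 ≤
        (∑ y ∈ cube n, |K (x * y)|) * ∑ y ∈ cube n, |K (x * y)| * p (f y) ^ 2 := by
      refine sum_sq_le_sum_mul_sum_of_sq_le_mul _ (fun _ _ => abs_nonneg _)
        (fun _ _ => by positivity) (fun y _ => le_of_eq (by ring))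
    rw [sum_cube_mul_left hx (fun y => |K y|)] at e2
    refine (pow_le_pow_left₀ (apply_nonneg p _) e1 2).trans ?_
    rw [mul_pow]
    exact mul_le_mul_of_nonneg_left e2 (sq_nonneg _)
  refine (sum_le_sum h1).trans ?_
  rw [← mul_sum, ← mul_sum, sum_comm]
  have h3 : ∀ y ∈ cube n, ∑ x ∈ cube n, |K (x * y)| * p (f y) ^ 2 = B * p (f y) ^ 2 := by
    intro y hy
    rw [← sum_mul]
    simp only [mul_comm _ y]
    rw [sum_cube_mul_left hy (fun y => |K y|)]
  rw [sum_congr rfl h3, ← mul_sum, ← mul_assoc, ← mul_assoc]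
  refine mul_le_mul_of_nonneg_right ?_ (sum_nonneg fun _ _ => sq_nonneg _)
  calc c ^ 2 * B * B = (c * B) ^ 2 := by ring
    _ ≤ A ^ 2 := pow_le_pow_left₀ (by positivity) hA 2

theorem sum_cube_prod_one_add {n : ℕ} (r : ℝ) :
    ∑ x ∈ cube n, ∏ j, (1 + r * x j) = 2 ^ n := by
  rw [sum_cube_prod (fun _ t => 1 + r * t)]
  ring_nf
  simp

theorem prod_one_add_nonneg {n : ℕ} {r : ℝ} (hr : |r| ≤ 1) {x : Fin n → ℝ} (hx : x ∈ cube n) :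
    0 ≤ ∏ j, (1 + r * x j) := by
  rw [mem_cube] at hx
  rw [abs_le] at hr
  refine prod_nonneg fun j _ => ?_
  rcases hx j with h | h <;> rw [h] <;> linarith

theorem sum_walsh_mul_prod_one_add {n : ℕ} (r : ℝ) (S : Finset (Fin n)) :
    ∑ x ∈ cube n, walsh S x * ∏ j, (1 + r * x j) = 2 ^ n * r ^ #S := by
  simp only [walsh_eq_prod_univ, ← prod_mul_distrib]
  rw [sum_cube_prod (fun j t => (if j ∈ S then t else 1) * (1 + r * t))]
  have : ∀ j : Fin n, ((if j ∈ S then (-1 : ℝ) else 1) * (1 + r * -1) +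
      (if j ∈ S then (1 : ℝ) else 1) * (1 + r * 1)) = 2 * if j ∈ S then r else 1 := by
    intro j
    split_ifs <;> ring
  simp only [this]
  rw [prod_mul_distrib, prod_ite_mem, univ_inter]
  simp

theorem sum_walsh_mul_sum_coord {n : ℕ} (S : Finset (Fin n)) :
    ∑ x ∈ cube n, walsh S x * ∑ j, x j = if #S = 1 then (2 : ℝ) ^ n else 0 := by
  have key : ∀ i : Fin n, ∑ x ∈ cube n, walsh S x * x i = if S = {i} then (2 : ℝ) ^ n else 0 := by
    intro i
    have e : ∀ x : Fin n → ℝ, walsh S x * x i =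
        ∏ j, ((if j ∈ S then x j else 1) * if j = i then x j else 1) := by
      intro x
      rw [prod_mul_distrib, ← walsh_eq_prod_univ, prod_ite_eq' univ i, if_pos (mem_univ i)]
    simp only [e]
    rw [sum_cube_prod (fun j t => (if j ∈ S then t else 1) * if j = i then t else 1)]
    split_ifs with h
    · subst h
      rw [prod_congr rfl (g := fun _ => (2 : ℝ)) fun j _ => by
        simp only [mem_singleton]; split_ifs <;> norm_num]
      simp
    · obtain ⟨j, hj⟩ : ∃ j, ¬ (j ∈ S ↔ j = i) := by
        by_contra! hh
        exact h (by ext j; simp [hh j])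
      refine prod_eq_zero (mem_univ j) ?_
      by_cases h1 : j ∈ S
      · have h2 : j ≠ i := fun h => hj (iff_of_true h1 h)
        simp only [if_pos h1, if_neg h2]
        norm_num
      · have h2 : j = i := by_contra fun h => hj (iff_of_false h1 h)
        simp only [if_neg h1, if_pos h2]
        norm_num
  simp only [mul_sum]
  rw [sum_comm, sum_congr rfl fun i _ => key i]
  split_ifs with h
  · obtain ⟨i, rfl⟩ := card_eq_one.1 h
    simp
  · refine sum_eq_zero fun i _ => if_neg ?_
    rintro rfl
    exact h (card_singleton i)

theorem euclNorm_sq (m : ℕ) (x : Fin m → ℝ) : euclNorm m x ^ 2 = ∑ i, x i ^ 2 :=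
  Real.sq_sqrt (sum_nonneg fun _ _ => sq_nonneg _)

theorem euclNorm_eq_norm (m : ℕ) (x : Fin m → ℝ) : euclNorm m x = ‖WithLp.toLp 2 x‖ := by
  simp [euclNorm, EuclideanSpace.norm_eq]

/-- Equivalence of an arbitrary norm on `ℝ^m` with the Euclidean norm. -/
theorem exists_euclNorm_equiv {m : ℕ} (p : Seminorm ℝ (Fin m → ℝ)) (hp : ∀ x, p x = 0 → x = 0) :
    ∃ c d : ℝ, 0 < c ∧ ∀ x, c * euclNorm m x ≤ p x ∧ p x ≤ d * euclNorm m x := by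
  let q : Seminorm ℝ (EuclideanSpace ℝ (Fin m)) :=
    p.comp (WithLp.linearEquiv 2 ℝ (Fin m → ℝ)).toLinearMap
  have hq : ∀ x, q (WithLp.toLp 2 x) = p x := fun x => rfl
  have hq0 : ∀ x, q x = 0 → x = 0 := by
    intro x hx
    have := hp x.ofLp hx
    ext i
    simp [this]
  have hcont : Continuous q := by
    have h : ConvexOn ℝ Set.univ q := q.convexOn
    exact continuousOn_univ.1 (h.continuousOn isOpen_univ)
  have homog : ∀ x : EuclideanSpace ℝ (Fin m), x ≠ 0 →
      q x = ‖x‖ * q (‖x‖⁻¹ • x) ∧ ‖x‖⁻¹ • x ∈ Metric.sphere (0 : EuclideanSpace ℝ (Fin m)) 1 := by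
    intro x hx
    have hn : ‖x‖ ≠ 0 := norm_ne_zero_iff.2 hx
    constructor
    · rw [map_smul_eq_mul, norm_inv, norm_norm, mul_inv_cancel_left₀ hn]
    · rw [mem_sphere_zero_iff_norm, norm_smul, norm_inv, norm_norm, inv_mul_cancel₀ hn]
  by_cases hs : (Metric.sphere (0 : EuclideanSpace ℝ (Fin m)) 1).Nonempty
  · obtain ⟨a, ha, hmin⟩ := (isCompact_sphere _ _).exists_isMinOn hs hcont.continuousOn
    obtain ⟨b, hb, hmax⟩ := (isCompact_sphere _ _).exists_isMaxOn hs hcont.continuousOn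
    have ha0 : a ≠ 0 := by rintro rfl; simp at ha
    refine ⟨q a, q b, lt_of_le_of_ne (apply_nonneg q a) fun h => ha0 (hq0 a h.symm), fun x => ?_⟩
    rw [euclNorm_eq_norm, ← hq]
    by_cases hx : WithLp.toLp 2 x = 0
    · simp [hx]
    · obtain ⟨h1, h2⟩ := homog _ hx
      rw [h1, mul_comm _ ‖_‖, mul_comm _ ‖_‖]
      exact ⟨mul_le_mul_of_nonneg_left (hmin h2) (norm_nonneg _),
        mul_le_mul_of_nonneg_left (hmax h2) (norm_nonneg _)⟩
  · refine ⟨1, 1, one_pos, fun x => ?_⟩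
    have hx : WithLp.toLp 2 x = 0 := by
      by_contra hx
      exact hs ⟨_, (homog _ hx).2⟩
    rw [euclNorm_eq_norm, ← hq, hx]
    simp

/-- If a seminorm is `2^k`-equivalent to a Euclidean one, then the Rademacher projection has
`L²` norm at most `32k`. -/
theorem sum_sq_seminorm_rad_le {n m k : ℕ} (hk : 1 ≤ k) (p : Seminorm ℝ (Fin m → ℝ))
    (T : (Fin m → ℝ) →ₗ[ℝ] (Fin m → ℝ)) {Δ : ℝ} (hΔ0 : 0 ≤ Δ) (hΔ : Δ ≤ 2 ^ k)
    (hT : ∀ x, euclNorm m (T x) ≤ p x ∧ p x ≤ Δ * euclNorm m (T x))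
    (f : (Fin n → ℝ) → (Fin m → ℝ)) :
    ∑ x ∈ cube n, p (rad n f x) ^ 2 ≤ (32 * k) ^ 2 * ∑ x ∈ cube n, p (f x) ^ 2 := by
  obtain ⟨d, hd⟩ : ∃ d, d = 4 * k := ⟨_, rfl⟩
  obtain ⟨M, w, s, hs, hw, hmom⟩ := exists_linear_coeff_quadrature d (by omega)
  have h2n : (0 : ℝ) < 2 ^ n := by positivity
  set Q : (Fin n → ℝ) → ℝ := fun y => ∑ i ∈ range M, 2 * w i * ∏ j, (1 + s i / 2 * y j) with hQ
  set K : (Fin n → ℝ) → ℝ := fun y => ∑ j, y j - Q y with hK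
  have hs2 : ∀ i, |s i / 2| ≤ 1 / 2 := by
    intro i
    rw [abs_div, abs_two]
    linarith [hs i]
  have hQ1 : ((2 : ℝ) ^ n)⁻¹ * ∑ x ∈ cube n, |Q x| ≤ 16 * k := by
    have h1 : ∀ x ∈ cube n, |Q x| ≤ ∑ i ∈ range M, 2 * |w i| * ∏ j, (1 + s i / 2 * x j) := by
      intro x hx
      refine (abs_sum_le_sum_abs _ _).trans (sum_le_sum fun i _ => ?_)
      rw [abs_mul, abs_mul, abs_two,
        abs_of_nonneg (prod_one_add_nonneg ((hs2 i).trans (by norm_num)) hx)]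
    have h2 : ∑ x ∈ cube n, |Q x| ≤ 2 ^ n * (2 * ∑ i ∈ range M, |w i|) := by
      refine (sum_le_sum h1).trans (le_of_eq ?_)
      rw [sum_comm, mul_sum, mul_sum]
      refine sum_congr rfl fun i _ => ?_
      rw [← mul_sum, sum_cube_prod_one_add]
      ring
    rw [inv_mul_le_iff₀ h2n]
    refine h2.trans (mul_le_mul_of_nonneg_left ?_ h2n.le)
    rw [hd] at hw
    push_cast at hw
    linarith
  have hKhat : ∀ S, |((2 : ℝ) ^ n)⁻¹ * ∑ x ∈ cube n, walsh S x * K x| ≤ 2 * d / 2 ^ d := by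
    intro S
    have e : ((2 : ℝ) ^ n)⁻¹ * ∑ x ∈ cube n, walsh S x * K x =
        (if #S = 1 then 1 else 0) - 2 * ∑ i ∈ range M, w i * (s i / 2) ^ #S := by
      have e1 : ∑ x ∈ cube n, walsh S x * Q x =
          2 ^ n * (2 * ∑ i ∈ range M, w i * (s i / 2) ^ #S) := by
        simp only [hQ, mul_sum]
        rw [sum_comm]
        refine sum_congr rfl fun i _ => ?_
        simp only [mul_left_comm (walsh S _)]
        rw [← mul_sum, sum_walsh_mul_prod_one_add]
        ring
      simp only [hK, mul_sub, sum_sub_distrib]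
      rw [e1, sum_walsh_mul_sum_coord, inv_mul_cancel_left₀ h2n.ne']
      congr 1
      split_ifs
      · exact inv_mul_cancel₀ h2n.ne'
      · simp
    rw [e]
    by_cases hS : #S ≤ d
    · have : ∑ i ∈ range M, w i * (s i / 2) ^ #S = (if #S = 1 then 1 else 0) / 2 ^ #S := by
        rw [← hmom _ hS, sum_div]
        exact sum_congr rfl fun i _ => by rw [div_pow, mul_div_assoc]
      rw [this]
      have h0 : (0 : ℝ) ≤ 2 * d / 2 ^ d := by positivity
      split_ifs with h
      · rw [h]; norm_num; exact h0
      · simpa using h0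
    · rw [if_neg (by omega), zero_sub, abs_neg, abs_mul, abs_two]
      have h1 : ∀ i ∈ range M, |w i * (s i / 2) ^ #S| ≤ |w i| * (1 / 2) ^ (d + 1) := by
        intro i _
        rw [abs_mul, abs_pow]
        refine mul_le_mul_of_nonneg_left ?_ (abs_nonneg _)
        exact (pow_le_pow_left₀ (abs_nonneg _) (hs2 i) _).trans
          (pow_le_pow_of_le_one (by norm_num) (by norm_num) (by omega))
      have h2 := (abs_sum_le_sum_abs _ _).trans (sum_le_sum h1)
      rw [← sum_mul] at h2
      have h3 : (∑ i ∈ range M, |w i|) * (1 / 2 : ℝ) ^ (d + 1) ≤ 2 * d * (1 / 2) ^ (d + 1) :=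
        mul_le_mul_of_nonneg_right hw (by positivity)
      have h4 : (2 : ℝ) * d / 2 ^ d = 2 * (2 * d * (1 / 2) ^ (d + 1)) := by
        rw [pow_succ, one_div, inv_pow]
        ring
      rw [h4]
      linarith
  have hsmall : Δ * (2 * d / 2 ^ d) ≤ 1 := by
    have hk8 : 8 * k ≤ 8 ^ k := by
      obtain ⟨j, rfl⟩ : ∃ j, k = j + 1 := ⟨k - 1, by omega⟩
      have : j < 8 ^ j := Nat.lt_pow_self (by norm_num)
      rw [pow_succ]
      omega
    have hk8' : (8 * k : ℝ) ≤ 8 ^ k := by exact_mod_cast hk8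
    rw [mul_div_assoc', div_le_one (by positivity), hd, pow_mul]
    calc Δ * (2 * ((4 * k : ℕ) : ℝ)) ≤ 2 ^ k * 8 ^ k := by
          refine mul_le_mul hΔ ?_ (by positivity) (by positivity)
          push_cast
          linarith
      _ = (2 ^ 4) ^ k := by rw [← mul_pow]; norm_num
  have hmain := sum_sq_seminorm_cubeConv_le p Q f (16 * k) hQ1
  have herr : ∑ x ∈ cube n, p (cubeConv n K f x) ^ 2 ≤ 1 * ∑ x ∈ cube n, p (f x) ^ 2 := by
    have hcoord : ∀ i x, (T (cubeConv n K f x)) i = cubeConv n K (fun y => T (f y) i) x :=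
      fun i x => map_cubeConv ((LinearMap.proj i).comp T) K f x
    calc ∑ x ∈ cube n, p (cubeConv n K f x) ^ 2
        ≤ ∑ x ∈ cube n, Δ ^ 2 * ∑ i, (cubeConv n K (fun y => T (f y) i) x) ^ 2 := by
          refine sum_le_sum fun x _ => ?_
          refine (pow_le_pow_left₀ (apply_nonneg p _) (hT _).2 2).trans (le_of_eq ?_)
          rw [mul_pow, euclNorm_sq]
          simp only [hcoord]
      _ = Δ ^ 2 * ∑ i, ∑ x ∈ cube n, (cubeConv n K (fun y => T (f y) i) x) ^ 2 := by
          rw [← mul_sum, sum_comm]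
      _ ≤ Δ ^ 2 * ∑ i, (2 * d / 2 ^ d) ^ 2 * ∑ x ∈ cube n, (T (f x) i) ^ 2 := by
          refine mul_le_mul_of_nonneg_left (sum_le_sum fun i _ => ?_) (sq_nonneg _)
          exact sum_sq_cubeConv_le K _ _ hKhat
      _ = (Δ * (2 * d / 2 ^ d)) ^ 2 * ∑ x ∈ cube n, euclNorm m (T (f x)) ^ 2 := by
          simp only [euclNorm_sq]
          rw [← mul_sum, sum_comm]
          ring
      _ ≤ 1 * ∑ x ∈ cube n, p (f x) ^ 2 := by
          refine mul_le_mul (pow_le_one₀ (by positivity) hsmall)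
            (sum_le_sum fun x _ => pow_le_pow_left₀ (Real.sqrt_nonneg _) (hT _).1 2)
            (sum_nonneg fun _ _ => sq_nonneg _) zero_le_one
  have hsplit : ∀ x ∈ cube n, p (rad n f x) ^ 2 ≤
      2 * p (cubeConv n Q f x) ^ 2 + 2 * p (cubeConv n K f x) ^ 2 := by
    intro x _
    have e : rad n f x = cubeConv n Q f x + cubeConv n K f x := by
      rw [rad_eq_cubeConv, ← cubeConv_add]
      simp [hK]
    have h1 := map_add_le_add p (cubeConv n Q f x) (cubeConv n K f x)
    rw [← e] at h1
    have h2 := pow_le_pow_left₀ (apply_nonneg p _) h1 2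
    nlinarith [sq_nonneg (p (cubeConv n Q f x) - p (cubeConv n K f x))]
  refine (sum_le_sum hsplit).trans ?_
  rw [sum_add_distrib, ← mul_sum, ← mul_sum]
  have hF : 0 ≤ ∑ x ∈ cube n, p (f x) ^ 2 := sum_nonneg fun _ _ => sq_nonneg _
  have hk' : (1 : ℝ) ≤ k := by exact_mod_cast hk
  have hk2 : (1 : ℝ) ≤ k ^ 2 := one_le_pow₀ hk'
  nlinarith [mul_le_mul_of_nonneg_right hk2 hF]

/-- A power of two above `t` whose exponent is controlled by the logarithm. -/
theorem exists_le_two_pow_log {t : ℝ} (ht : 1 ≤ t) :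
    ∃ k : ℕ, 1 ≤ k ∧ t ≤ 2 ^ k ∧ (k : ℝ) ≤ 4 * Real.log (t + 1) := by
  have hl2 : (0.69 : ℝ) < Real.log 2 := by linarith [Real.log_two_gt_d9]
  have hl : Real.log 2 ≤ Real.log (t + 1) := Real.log_le_log (by norm_num) (by linarith)
  refine ⟨⌈2 * Real.log (t + 1)⌉₊, Nat.one_le_iff_ne_zero.2 ?_, ?_, ?_⟩
  · exact (Nat.ceil_pos.2 (by linarith)).ne'
  · have h1 : 2 * Real.log (t + 1) ≤ (⌈2 * Real.log (t + 1)⌉₊ : ℝ) := Nat.le_ceil _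
    set k : ℕ := ⌈2 * Real.log (t + 1)⌉₊
    have h2 : t + 1 ≤ 2 ^ k := by
      rw [← Real.log_le_log_iff (by linarith) (by positivity), Real.log_pow]
      nlinarith
    linarith
  · have := Nat.ceil_lt_add_one (a := 2 * Real.log (t + 1)) (by linarith)
    linarith

theorem log_add_one_le_two_mul_log {s t : ℝ} (hs : 1 ≤ s) (ht : 0 < t) (hts : t < s + 1) :
    Real.log (t + 1) ≤ 2 * Real.log (s + 1) := by
  have : Real.log (t + 1) ≤ Real.log ((s + 1) ^ 2) :=
    Real.log_le_log (by linarith) (by nlinarith)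
  rwa [Real.log_pow, Nat.cast_ofNat] at this

/-- **Pisier's inequality, Banach–Mazur distance form.** -/
theorem pisier_inequality_banach_mazur :
    ∃ C : ℝ, 0 < C ∧
      ∀ (n m : ℕ), 1 ≤ n → 1 ≤ m →
      ∀ N : (Fin m → ℝ) → ℝ,
        (∀ x y, N (x + y) ≤ N x + N y) →
        (∀ (c : ℝ) (x), N (c • x) = |c| * N x) →
        (∀ x, N x = 0 → x = 0) →
        ∀ D : ℝ,
          D = sInf {d : ℝ | ∃ T : (Fin m → ℝ) ≃ₗ[ℝ] (Fin m → ℝ),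
                ∀ x, euclNorm m (T x) ≤ N x ∧ N x ≤ d * euclNorm m (T x)} →
        ∀ f : (Fin n → ℝ) → (Fin m → ℝ),
          Real.sqrt (cubeAvg n fun x => (N (rad n f x)) ^ 2) ≤
            C * Real.log (D + 1) *
              Real.sqrt (cubeAvg n fun x => (N (f x)) ^ 2) := by
  refine ⟨256, by norm_num, ?_⟩
  intro n m _ hm N hadd hsmul hzero D hD f
  let p : Seminorm ℝ (Fin m → ℝ) :=
    Seminorm.of N hadd fun c x => by rw [hsmul, Real.norm_eq_abs]
  have hpN : ∀ x, N x = p x := fun _ => rfl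
  set A := {d : ℝ | ∃ T : (Fin m → ℝ) ≃ₗ[ℝ] (Fin m → ℝ),
    ∀ x, euclNorm m (T x) ≤ N x ∧ N x ≤ d * euclNorm m (T x)} with hA
  have hne : A.Nonempty := by
    obtain ⟨c, d, hc, h⟩ := exists_euclNorm_equiv p hzero
    refine ⟨d / c, LinearEquiv.smulOfNeZero ℝ _ c hc.ne', fun x => ?_⟩
    have e : euclNorm m (LinearEquiv.smulOfNeZero ℝ (Fin m → ℝ) c hc.ne' x) =
        c * euclNorm m x := by
      rw [LinearEquiv.smulOfNeZero_apply, euclNorm_eq_norm, euclNorm_eq_norm, WithLp.toLp_smul,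
        norm_smul, Real.norm_of_nonneg hc.le]
    rw [e, hpN, ← mul_assoc, div_mul_cancel₀ _ hc.ne']
    exact h x
  have hge : ∀ d ∈ A, 1 ≤ d := by
    rintro d ⟨T, hT⟩
    let v : Fin m → ℝ := T.symm fun _ => 1
    have hv : 0 < euclNorm m (T v) := by
      rw [LinearEquiv.apply_symm_apply, euclNorm]
      refine Real.sqrt_pos.2 ?_
      simpa [Nat.pos_iff_ne_zero] using Nat.one_le_iff_ne_zero.1 hm
    have h := (hT v).1.trans (hT v).2
    exact (le_mul_iff_one_le_left hv).1 h
  have hD1 : 1 ≤ D := hD ▸ le_csInf hne hge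
  obtain ⟨Δ, hΔA, hΔD⟩ := exists_lt_of_csInf_lt hne (show sInf A < D + 1 by rw [← hD]; linarith)
  have hΔ1 := hge Δ hΔA
  obtain ⟨T, hT⟩ := hΔA
  obtain ⟨k, hk1, hΔk, hkl⟩ := exists_le_two_pow_log hΔ1
  have hlog := log_add_one_le_two_mul_log hD1 (by linarith) hΔD
  have hmain := sum_sq_seminorm_rad_le hk1 p T.toLinearMap (by linarith) hΔk hT f
  have hkC : (32 * k : ℝ) ≤ 256 * Real.log (D + 1) := by linarith
  refine le_trans ?_ (mul_le_mul_of_nonneg_right hkC (Real.sqrt_nonneg _))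
  rw [← Real.sqrt_sq (show (0 : ℝ) ≤ 32 * k by positivity), ← Real.sqrt_mul (sq_nonneg _)]
  refine Real.sqrt_le_sqrt ?_
  simp only [cubeAvg]
  rw [← mul_div_assoc]
  exact div_le_div_of_nonneg_right hmain (by positivity)
end
end

section
/- Let ℓ > 0 be an odd integer, let Γ = {2πj/(4ℓ) : j = 0, 1, …, 4ℓ−1}, let θ be uniformly distributed on the set Γ \ {0, π} (of size 4ℓ−2), and let φ(θ) = ((2ℓ−1)/ℓ)·sin(ℓθ)/sin²(θ). Then E[φ(θ)·sin^k(θ)] = 0 for k = 0 and for every integer k with 2 ≤ k ≤ ℓ. -/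
open Finset Real

noncomputable section

/-- The function `φ(θ) = ((2ℓ−1)/ℓ)·sin(ℓθ)/sin²(θ)`. -/
def phiFn (ℓ : ℕ) (θ : ℝ) : ℝ :=
  ((2 * (ℓ : ℝ) - 1) / ℓ) * Real.sin (ℓ * θ) / (Real.sin θ) ^ 2

/-- The `4ℓ` equally spaced angles `2πj/(4ℓ)`, `j = 0, …, 4ℓ−1`. -/
def gammaSet (ℓ : ℕ) : Finset ℝ :=
  (Finset.range (4 * ℓ)).image fun j : ℕ => 2 * π * (j : ℝ) / (4 * ℓ)

/-- The angles with the zeros `0, π` of `sin` removed. -/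
def gammaSet' (ℓ : ℕ) : Finset ℝ :=
  gammaSet ℓ \ {0, π}

/-- The `j`-th of the `4ℓ` equally spaced angles. -/
def gammaAngle (ℓ j : ℕ) : ℝ := 2 * π * (j : ℝ) / (4 * ℓ)

lemma sum_sin_equally_spaced {N a : ℕ} (ha : 0 < a) (haN : a < N) (c : ℝ) :
    ∑ j ∈ range N, Real.sin (a * (2 * π * j / N) + c) = 0 := by
  have hN : (0 : ℝ) < N := by exact_mod_cast ha.trans haN
  have ha' : (0 : ℝ) < a := by exact_mod_cast ha
  have haN' : (a : ℝ) < N := by exact_mod_cast haN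
  set x : ℝ := a * π / N with hx
  have hsin : 0 < Real.sin x := by
    apply Real.sin_pos_of_pos_of_lt_pi
    · positivity
    · rw [hx, div_lt_iff₀ hN]
      nlinarith [Real.pi_pos]
  have hterm : ∀ j : ℕ, 2 * Real.sin x * Real.sin (a * (2 * π * j / N) + c)
      = -Real.cos (2 * x * ((j + 1 : ℕ) : ℝ) - x + c) - -Real.cos (2 * x * (j : ℝ) - x + c) := by
    intro j
    have h₁ : a * (2 * π * j / N) + c = 2 * x * j + c := by rw [hx]; ring
    have h₂ : 2 * x * ((j + 1 : ℕ) : ℝ) - x + c = (2 * x * j + c) + x := by push_cast; ring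
    have h₃ : 2 * x * (j : ℝ) - x + c = (2 * x * j + c) - x := by ring
    rw [h₁, h₂, h₃, Real.cos_add (2 * x * j + c) x, Real.cos_sub]
    ring
  have hsum : 2 * Real.sin x * ∑ j ∈ range N, Real.sin (a * (2 * π * j / N) + c) = 0 := by
    rw [mul_sum, sum_congr rfl fun j _ => hterm j,
      sum_range_sub fun j : ℕ => -Real.cos (2 * x * (j : ℝ) - x + c)]
    have h : 2 * x * (N : ℝ) - x + c = (2 * x * ((0 : ℕ) : ℝ) - x + c) + a * (2 * π) := by
      rw [hx]; field_simp; push_cast; ring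
    rw [h, Real.cos_add_nat_mul_two_pi, sub_self]
  exact (mul_eq_zero.mp hsum).resolve_left (by positivity)

lemma sum_sin_mul_sin_pow_equally_spaced {N : ℕ} (m : ℕ) :
    ∀ (a : ℕ) (c : ℝ), m < a → a + m < N →
      ∑ j ∈ range N, Real.sin (a * (2 * π * j / N) + c) * Real.sin (2 * π * j / N) ^ m = 0 := by
  induction m with
  | zero =>
    intro a c h₁ h₂
    simpa using sum_sin_equally_spaced h₁ h₂ c
  | succ m ih =>
    intro a c h₁ h₂
    obtain ⟨b, rfl⟩ : ∃ b, a = b + 1 := ⟨a - 1, by omega⟩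
    have hb := ih b (c + π / 2) (by omega) (by omega)
    have hb₂ := ih (b + 2) (c + π / 2) (by omega) (by omega)
    have hterm : ∀ j : ℕ, Real.sin ((b + 1 : ℕ) * (2 * π * j / N) + c)
          * Real.sin (2 * π * j / N) ^ (m + 1)
        = (Real.sin (b * (2 * π * j / N) + (c + π / 2)) * Real.sin (2 * π * j / N) ^ m
          - Real.sin ((b + 2 : ℕ) * (2 * π * j / N) + (c + π / 2))
            * Real.sin (2 * π * j / N) ^ m) / 2 := by
      intro j
      generalize 2 * π * (j : ℝ) / N = t
      rw [← add_assoc, ← add_assoc, Real.sin_add_pi_div_two, Real.sin_add_pi_div_two]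
      have e₁ : (b : ℝ) * t + c = (((b + 1 : ℕ) : ℝ) * t + c) - t := by push_cast; ring
      have e₂ : ((b + 2 : ℕ) : ℝ) * t + c = (((b + 1 : ℕ) : ℝ) * t + c) + t := by push_cast; ring
      rw [e₁, e₂, Real.cos_add (((b + 1 : ℕ) : ℝ) * t + c) t,
        Real.cos_sub (((b + 1 : ℕ) : ℝ) * t + c) t]
      ring
    rw [sum_congr rfl fun j _ => hterm j, ← sum_div, sum_sub_distrib, hb, hb₂]
    simp

lemma gammaAngle_injective {ℓ : ℕ} (hℓ : 0 < ℓ) : Function.Injective (gammaAngle ℓ) := by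
  intro i j h
  have hℓ' : (0 : ℝ) < ℓ := by exact_mod_cast hℓ
  have hpi := Real.pi_pos
  unfold gammaAngle at h
  field_simp at h
  exact_mod_cast h

lemma gammaAngle_two_mul_self {ℓ : ℕ} (hℓ : 0 < ℓ) : gammaAngle ℓ (2 * ℓ) = π := by
  have hℓ' : (0 : ℝ) < ℓ := by exact_mod_cast hℓ
  unfold gammaAngle
  push_cast
  field_simp
  ring

lemma pair_subset_gammaSet {ℓ : ℕ} (hℓ : 0 < ℓ) : ({0, π} : Finset ℝ) ⊆ gammaSet ℓ := by
  intro x hx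
  rw [mem_insert, mem_singleton] at hx
  refine mem_image.mpr ?_
  rcases hx with rfl | rfl
  · exact ⟨0, mem_range.mpr (by omega), by simp⟩
  · exact ⟨2 * ℓ, mem_range.mpr (by omega), gammaAngle_two_mul_self hℓ⟩

lemma card_gammaSet' {ℓ : ℕ} (hℓ : 0 < ℓ) : (gammaSet' ℓ).card = 4 * ℓ - 2 := by
  rw [gammaSet', card_sdiff_of_subset (pair_subset_gammaSet hℓ), card_pair Real.pi_ne_zero.symm]
  congr 1
  exact (card_image_of_injective _ (gammaAngle_injective hℓ)).trans (card_range _)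

lemma phiFn_eq_zero_of_sin_eq_zero (ℓ : ℕ) {θ : ℝ} (h : Real.sin θ = 0) : phiFn ℓ θ = 0 := by
  simp [phiFn, h]

lemma sum_gammaSet'_phiFn_mul {ℓ : ℕ} (hℓ : 0 < ℓ) (g : ℝ → ℝ) :
    ∑ θ ∈ gammaSet' ℓ, phiFn ℓ θ * g θ
      = ∑ j ∈ range (4 * ℓ), phiFn ℓ (gammaAngle ℓ j) * g (gammaAngle ℓ j) := by
  have hpair : ∑ θ ∈ ({0, π} : Finset ℝ), phiFn ℓ θ * g θ = 0 := by
    rw [sum_pair Real.pi_ne_zero.symm, phiFn_eq_zero_of_sin_eq_zero ℓ Real.sin_zero,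
      phiFn_eq_zero_of_sin_eq_zero ℓ Real.sin_pi]
    simp
  have h := sum_sdiff (f := fun θ => phiFn ℓ θ * g θ) (pair_subset_gammaSet hℓ)
  rw [hpair, add_zero] at h
  exact h.trans (sum_image (gammaAngle_injective hℓ).injOn)

lemma phiFn_add_pi {ℓ : ℕ} (hodd : Odd ℓ) (θ : ℝ) : phiFn ℓ (θ + π) = -phiFn ℓ θ := by
  simp only [phiFn, mul_add, Real.sin_add_nat_mul_pi, hodd.neg_one_pow, Real.sin_add_pi]
  ring

lemma sum_phiFn_gammaAngle {ℓ : ℕ} (hℓ : 0 < ℓ) (hodd : Odd ℓ) :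
    ∑ j ∈ range (4 * ℓ), phiFn ℓ (gammaAngle ℓ j) = 0 := by
  have hshift : ∀ j, gammaAngle ℓ (2 * ℓ + j) = gammaAngle ℓ j + π := by
    intro j
    rw [← gammaAngle_two_mul_self hℓ]
    simp only [gammaAngle]
    push_cast
    ring
  rw [show 4 * ℓ = 2 * ℓ + 2 * ℓ by ring, sum_range_add]
  simp only [hshift, phiFn_add_pi hodd, sum_neg_distrib, add_neg_cancel]

lemma sin_natCast_mul_eq_zero (n : ℕ) {θ : ℝ} (h : Real.sin θ = 0) : Real.sin (n * θ) = 0 := by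
  obtain ⟨z, rfl⟩ := Real.sin_eq_zero_iff.mp h
  simpa [mul_assoc] using Real.sin_int_mul_pi (n * z)

lemma phiFn_mul_sin_pow_add_two (ℓ m : ℕ) (θ : ℝ) :
    phiFn ℓ θ * Real.sin θ ^ (m + 2)
      = ((2 * (ℓ : ℝ) - 1) / ℓ) * (Real.sin (ℓ * θ) * Real.sin θ ^ m) := by
  by_cases h : Real.sin θ = 0
  · simp [phiFn, h, sin_natCast_mul_eq_zero ℓ h]
  · rw [phiFn, pow_add]
    field_simp

/-- For `θ` uniform on `Γ \ {0, π}` (a set of size `4ℓ−2`), `E[φ(θ)·sin^k(θ)] = 0`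
for `k = 0` and for every `2 ≤ k ≤ ℓ`. -/
theorem phi_expectation_sin_pow (ℓ : ℕ) (hℓ : 0 < ℓ) (hodd : Odd ℓ) :
    (gammaSet' ℓ).card = 4 * ℓ - 2 ∧
    ∀ k : ℕ, k = 0 ∨ (2 ≤ k ∧ k ≤ ℓ) →
      (∑ θ ∈ gammaSet' ℓ, phiFn ℓ θ * Real.sin θ ^ k) / ((gammaSet' ℓ).card : ℝ) = 0 := by
  refine ⟨card_gammaSet' hℓ, fun k hk => ?_⟩
  rw [sum_gammaSet'_phiFn_mul hℓ fun θ => Real.sin θ ^ k]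
  rcases hk with rfl | ⟨hk₂, hkℓ⟩
  · simp [sum_phiFn_gammaAngle hℓ hodd]
  · obtain ⟨m, rfl⟩ : ∃ m, k = m + 2 := ⟨k - 2, by omega⟩
    have h := sum_sin_mul_sin_pow_equally_spaced (N := 4 * ℓ) m ℓ 0 (by omega) (by omega)
    simp only [add_zero, Nat.cast_mul, Nat.cast_ofNat] at h
    simp only [phiFn_mul_sin_pow_add_two, ← mul_sum, gammaAngle, h, mul_zero, zero_div]
end
end
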